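/- Fix strictly increasing α, β : ℚ → ℚ with α x < β x < α (x + ε) for all x and all ε > 0, and let mx be the induced operation. Then mx preserves the ternary relation X = { (x, y, z) : ℚ³ | (x = y ∧ y < z) ∨ (x = z ∧ z < y) ∨ (y = z ∧ y < x) }: for all (x, y, z), (x', y', z') ∈ X, the triple (mx x x', mx y y', mx z z') lies in X. -/

import Mathlib

/-- The operation `mx` induced by unary operations `α`, `β`. -/
def mxOp (α β : ℚ → ℚ) : ℚ → ℚ → ℚ :=
  fun x y => if x = y then β x else α (min x y)

theorem mxOp_of_lt {α β : ℚ → ℚ} {a b : ℚ} (h : a < b) : mxOp α β a b = α a := by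
  simp [mxOp, h.ne, h.le]

theorem mxOp_of_gt {α β : ℚ → ℚ} {a b : ℚ} (h : b < a) : mxOp α β a b = α b := by
  simp [mxOp, h.ne', h.le]

theorem mxOp_self {α β : ℚ → ℚ} (a : ℚ) : mxOp α β a a = β a := by
  simp [mxOp]

theorem apply_min_le_mxOp {α β : ℚ → ℚ} (h : ∀ x, α x < β x) (a b : ℚ) :
    α (min a b) ≤ mxOp α β a b := by
  rcases eq_or_ne a b with rfl | hab
  · simpa [mxOp] using (h a).le
  · simp [mxOp, hab]

/-- `mxOp` is strictly monotone when both arguments increase strictly. -/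
theorem mxOp_lt_mxOp {α β : ℚ → ℚ} (hα : StrictMono α) (h : ∀ x, α x < β x)
    (h' : ∀ x y, x < y → β x < α y) {a b c d : ℚ} (hab : a < b) (hcd : c < d) :
    mxOp α β a c < mxOp α β b d := by
  refine lt_of_lt_of_le ?_ (apply_min_le_mxOp h b d)
  rcases lt_trichotomy a c with hac | rfl | hac
  · rw [mxOp_of_lt hac]
    exact hα (lt_min hab (hac.trans hcd))
  · rw [mxOp_self]
    exact h' _ _ (lt_min hab hcd)
  · rw [mxOp_of_gt hac]
    exact hα (lt_min (hac.trans hab) hcd)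

/-- If `a < b` and `c < d`, the two smaller values among `mxOp a c`, `mxOp a d`, `mxOp b c`
coincide, and the third is strictly larger. -/
theorem mxOp_two_minima {α β : ℚ → ℚ} (hα : StrictMono α) (h : ∀ x, α x < β x)
    {a b c d : ℚ} (hab : a < b) (hcd : c < d) :
    (mxOp α β a c = mxOp α β a d ∧ mxOp α β a d < mxOp α β b c) ∨
    (mxOp α β a c = mxOp α β b c ∧ mxOp α β b c < mxOp α β a d) ∨
    (mxOp α β a d = mxOp α β b c ∧ mxOp α β a d < mxOp α β a c) := by
  rcases lt_trichotomy a c with hac | rfl | hac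
  · rw [mxOp_of_lt hac, mxOp_of_lt (hac.trans hcd)]
    exact .inl ⟨rfl, (hα (lt_min hab hac)).trans_le (apply_min_le_mxOp h b c)⟩
  · rw [mxOp_self, mxOp_of_lt hcd, mxOp_of_gt hab]
    exact .inr (.inr ⟨rfl, h a⟩)
  · rw [mxOp_of_gt hac, mxOp_of_gt (hac.trans hab)]
    exact .inr (.inl ⟨rfl, (hα (lt_min hac hcd)).trans_le (apply_min_le_mxOp h a d)⟩)

theorem mx_preserves_X (α β : ℚ → ℚ)
    (hα : StrictMono α) (hβ : StrictMono β)
    (hαβ : ∀ x ε : ℚ, 0 < ε → α x < β x ∧ β x < α (x + ε)) :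
    ∀ x y z x' y' z' : ℚ,
      ((x = y ∧ y < z) ∨ (x = z ∧ z < y) ∨ (y = z ∧ y < x)) →
      ((x' = y' ∧ y' < z') ∨ (x' = z' ∧ z' < y') ∨ (y' = z' ∧ y' < x')) →
      ((mxOp α β x x' = mxOp α β y y' ∧ mxOp α β y y' < mxOp α β z z') ∨
       (mxOp α β x x' = mxOp α β z z' ∧ mxOp α β z z' < mxOp α β y y') ∨
       (mxOp α β y y' = mxOp α β z z' ∧ mxOp α β y y' < mxOp α β x x')) := by
  have h : ∀ x, α x < β x := fun x => (hαβ x 1 one_pos).1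
  have h' : ∀ x y, x < y → β x < α y := fun x y hxy => by
    simpa using (hαβ x (y - x) (sub_pos.2 hxy)).2
  rintro x y z x' y' z' (⟨rfl, hlt⟩ | ⟨rfl, hlt⟩ | ⟨rfl, hlt⟩)
    (⟨rfl, hlt'⟩ | ⟨rfl, hlt'⟩ | ⟨rfl, hlt'⟩)
  all_goals
    have same := mxOp_lt_mxOp hα h h' hlt hlt'
    have diff := mxOp_two_minima hα h hlt hlt'
    clear h h' hα hβ hαβ
    grind
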